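/- arXiv:math/0607518 — 3 statements merged into one kernel-verified Lean document; each statement's English description precedes it below -/
import Mathlib

section
/- (Lemma 2.3) For every Λ_A-admissible word μ₁⋯μ_l and every k with 1 ≤ k ≤ l, the k-predecessor set of the word β_{μ₁}⋯β_{μ_l} in D_A equals the k-predecessor set of the vertex μ₁⋯μ_l ∈ V_l in the Cantor horizon λ-graph system: Γ^k_{D_A}(β_{μ₁}⋯β_{μ_l}) = Γ^k_{L^{Ch(D_A)}}(μ₁⋯μ_l). -/
open scoped BigOperators

/-- A word over `{1,…,N}` is `Λ_A`-admissible if consecutive letters obey `A`. -/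
def MarkovAdm {N : ℕ} (A : Fin N → Fin N → Bool) (w : List (Fin N)) : Prop :=
  w.Chain' fun i j => A i j = true

/-- The one-sided topological Markov shift space `X_{Λ_A}`. -/
def XMarkov {N : ℕ} (A : Fin N → Fin N → Bool) : Type :=
  {x : ℕ → Fin N // ∀ n, A (x n) (x (n + 1)) = true}

/-- Prepend a symbol to a one-sided sequence. -/
def consSeq {N : ℕ} (i : Fin N) (x : ℕ → Fin N) : ℕ → Fin N
  | 0 => i
  | n + 1 => x n

/-- The partial map `τ_i` (creation: `x ↦ ix` when `A(i,x₁)=1`), i.e. `φ(β_i)`. -/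
def tauBeta {N : ℕ} (A : Fin N → Fin N → Bool) (i : Fin N) (x : XMarkov A) :
    Option (XMarkov A) :=
  if h : A i (x.1 0) = true then
    some ⟨consSeq i x.1, by
      intro n
      cases n with
      | zero => simpa [consSeq] using h
      | succ m => simpa [consSeq] using x.2 m⟩
  else none

/-- The partial map `τ_i⁻¹` (deletes the first symbol when it equals `i`), i.e. `φ(α_i)`. -/
def tauAlpha {N : ℕ} (A : Fin N → Fin N → Bool) (i : Fin N) (x : XMarkov A) :
    Option (XMarkov A) :=
  if x.1 0 = i then some ⟨fun n => x.1 (n + 1), fun n => x.2 (n + 1)⟩ else none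

/-- The alphabet `Σ`: `Sum.inl i = α_i`, `Sum.inr i = β_i`. -/
abbrev DyckSym (N : ℕ) := Fin N ⊕ Fin N

/-- `φ(α_i) = τ_i⁻¹`, `φ(β_i) = τ_i`. -/
def phiMap {N : ℕ} (A : Fin N → Fin N → Bool) :
    DyckSym N → XMarkov A → Option (XMarkov A)
  | Sum.inl i => tauAlpha A i
  | Sum.inr i => tauBeta A i

/-- The composite partial map `φ(γ₁)∘⋯∘φ(γ_n)` (rightmost applied first) applied to `x`. -/
def applyWord {N : ℕ} (A : Fin N → Fin N → Bool) (w : List (DyckSym N))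
    (x : XMarkov A) : Option (XMarkov A) :=
  w.foldr (fun γ o => o.bind (phiMap A γ)) (some x)

/-- A word over `Σ` is `D_A`-admissible if the composite partial map has nonempty domain. -/
def DAdm {N : ℕ} (A : Fin N → Fin N → Bool) (w : List (DyckSym N)) : Prop :=
  ∃ x : XMarkov A, (applyWord A w x).isSome

/-- Labeled edges of the Cantor horizon λ-graph system `L^{Ch(D_A)}`: vertices at
level `l` are the `Λ_A`-admissible words of length `l` (`[]` is the level-0 vertex `∅`),
and `LEdge A u v γ` says there is an edge labeled `γ` from `u` to `v`.
An `α_j`-edge goes from `μ₁⋯μ_l` to `μ₀μ₁⋯μ_l` exactly when `μ₀ = j`; a `β_j`-edge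
goes from `jν₁⋯ν_{l-1}` to `ν₁⋯ν_{l+1}` (for `l = 0,1` from `∅` to `(i)` with
`A(j,i) = 1`, resp. from `(j)` to `ν₁ν₂` with `A(j,ν₁) = 1`). -/
def LEdge {N : ℕ} (A : Fin N → Fin N → Bool) (u v : List (Fin N)) :
    DyckSym N → Prop
  | Sum.inl j => MarkovAdm A u ∧ MarkovAdm A v ∧ v = j :: u
  | Sum.inr j =>
      MarkovAdm A u ∧ MarkovAdm A v ∧ v.length = u.length + 1 ∧
      (∀ h, u.head? = some h → h = j) ∧
      u.tail = v.take (u.length - 1) ∧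
      ∃ h, v.head? = some h ∧ A j h = true

/-- `RPathTo A w v` : the *reversed* label list `w` (last edge first) is the label
sequence of a path in `L^{Ch(D_A)}` ending at the vertex `v`. -/
def RPathTo {N : ℕ} (A : Fin N → Fin N → Bool) :
    List (DyckSym N) → List (Fin N) → Prop
  | [], v => MarkovAdm A v
  | γ :: w, v => ∃ u, LEdge A u v γ ∧ RPathTo A w u

/-- The word formed by the first `n` symbols of a one-sided sequence. -/
def seqPrefix {N : ℕ} (y : ℕ → Fin N) (n : ℕ) : List (Fin N) :=
  (List.range n).map y

theorem seqPrefix_succ {N : ℕ} (y : ℕ → Fin N) (n : ℕ) :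
    seqPrefix y (n + 1) = y 0 :: seqPrefix (fun m => y (m + 1)) n := by
  simp [seqPrefix, List.range_succ_eq_map, Function.comp_def]

@[simp] theorem length_seqPrefix {N : ℕ} (y : ℕ → Fin N) (n : ℕ) :
    (seqPrefix y n).length = n := by
  simp [seqPrefix]

theorem take_seqPrefix {N : ℕ} (y : ℕ → Fin N) {m n : ℕ} (h : m ≤ n) :
    (seqPrefix y n).take m = seqPrefix y m := by
  simp [seqPrefix, ← List.map_take, List.take_range, h]

theorem markovAdm_seqPrefix {N : ℕ} {A : Fin N → Fin N → Bool} (y : XMarkov A) (n : ℕ) :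
    MarkovAdm A (seqPrefix y.1 n) := by
  refine List.isChain_iff_getElem.2 fun i h => ?_
  simpa [seqPrefix] using y.2 i

theorem applyWord_append {N : ℕ} (A : Fin N → Fin N → Bool) (w w' : List (DyckSym N))
    (x : XMarkov A) :
    applyWord A (w ++ w') x = (applyWord A w' x).bind (applyWord A w) := by
  induction w with
  | nil => exact (Option.bind_fun_some (applyWord A w' x)).symm
  | cons γ w ih =>
    have hcons : ∀ v : List (DyckSym N), ∀ z : XMarkov A,
        applyWord A (γ :: v) z = (applyWord A v z).bind (phiMap A γ) := fun _ _ => rfl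
    rw [List.cons_append, hcons, ih, Option.bind_assoc]
    simp only [hcons]

/-- For `w` no longer than `n`, whether `w` is defined at `y` is decided by the vertex given by
the first `n` symbols of `y`. -/
theorem isSome_applyWord_reverse_iff {N : ℕ} {A : Fin N → Fin N → Bool}
    (w : List (DyckSym N)) (n : ℕ) (hn : w.length ≤ n) (y : XMarkov A) :
    (applyWord A w.reverse y).isSome ↔ RPathTo A w (seqPrefix y.1 n) := by
  induction w generalizing n y with
  | nil => simpa [applyWord, RPathTo] using markovAdm_seqPrefix y n
  | cons γ w ih =>
    obtain ⟨n, rfl⟩ : ∃ m, n = m + 1 := ⟨n - 1, by simp at hn; omega⟩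
    replace hn : w.length ≤ n := by simpa using hn
    have hstep : applyWord A [γ] y = phiMap A γ y := rfl
    rw [List.reverse_cons, applyWord_append, hstep, RPathTo]
    cases γ with
    | inl j =>
      simp only [phiMap, tauAlpha]
      split_ifs with h
      · refine (ih n hn _).trans ?_
        constructor
        · intro hw
          exact ⟨_, ⟨markovAdm_seqPrefix _ n, markovAdm_seqPrefix y _,
            by rw [seqPrefix_succ, h]⟩, hw⟩
        · rintro ⟨u, ⟨-, -, hu⟩, hw⟩
          rw [seqPrefix_succ, List.cons.injEq] at hu
          rwa [hu.2]
      · simp only [Option.bind_none, Option.isSome_none, Bool.false_eq_true, false_iff]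
        rintro ⟨u, ⟨-, -, hu⟩, -⟩
        rw [seqPrefix_succ, List.cons.injEq] at hu
        exact h hu.1
    | inr j =>
      simp only [phiMap, tauBeta]
      split_ifs with h
      · refine (ih n hn _).trans ?_
        constructor
        · intro hw
          refine ⟨_, ⟨markovAdm_seqPrefix _ n, markovAdm_seqPrefix y _, by simp, ?_, ?_,
            y.1 0, by simp [seqPrefix_succ], h⟩, hw⟩
          · cases n with
            | zero => simp [seqPrefix]
            | succ n => simp [seqPrefix_succ, consSeq]
          · rw [length_seqPrefix, take_seqPrefix _ (by omega)]
            cases n <;> simp [seqPrefix_succ, consSeq] <;> rfl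
        · rintro ⟨u, ⟨-, -, hl, hh, ht, -⟩, hw⟩
          replace hl : u.length = n := by simpa using hl.symm
          convert hw
          rw [hl, take_seqPrefix _ (by omega)] at ht
          cases u with
          | nil => subst hl; rfl
          | cons a u =>
            obtain rfl := hh a rfl
            subst hl
            simpa [seqPrefix_succ, consSeq] using ht.symm
      · simp only [Option.bind_none, Option.isSome_none, Bool.false_eq_true, false_iff]
        rintro ⟨u, ⟨-, -, -, -, -, a, ha, hja⟩, -⟩
        rw [seqPrefix_succ, List.head?_cons, Option.some.injEq] at ha
        exact h (ha ▸ hja)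

/-- Creating the word `μ` yields a sequence that starts with `μ`. -/
theorem seqPrefix_of_applyWord_map_inr {N : ℕ} {A : Fin N → Fin N → Bool}
    (μ : List (Fin N)) {x y : XMarkov A} (h : applyWord A (μ.map Sum.inr) x = some y) :
    seqPrefix y.1 μ.length = μ := by
  induction μ generalizing y with
  | nil => rfl
  | cons a μ ih =>
    have hb : (applyWord A (μ.map Sum.inr) x).bind (tauBeta A a) = some y := h
    obtain ⟨z, hz, hzy⟩ := Option.bind_eq_some_iff.1 hb
    rw [tauBeta] at hzy
    split_ifs at hzy
    obtain rfl := Option.some.inj hzy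
    rw [List.length_cons, seqPrefix_succ]
    exact congrArg (a :: ·) (ih hz)

theorem exists_applyWord_map_inr {N : ℕ} {A : Fin N → Fin N → Bool} (μ : List (Fin N))
    (x : XMarkov A) (h : MarkovAdm A (μ ++ [x.1 0])) :
    ∃ y, applyWord A (μ.map Sum.inr) x = some y ∧ (μ ++ [x.1 0]).head? = some (y.1 0) := by
  induction μ with
  | nil => exact ⟨x, rfl, rfl⟩
  | cons a μ ih =>
    replace h := List.isChain_cons.1 h
    obtain ⟨z, hz, hz0⟩ := ih h.2
    have ha : A a (z.1 0) = true := h.1 _ hz0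
    have hb : applyWord A ((a :: μ).map Sum.inr) x =
        (applyWord A (μ.map Sum.inr) x).bind (tauBeta A a) := rfl
    rw [hb, hz, Option.bind_some, tauBeta, dif_pos ha]
    exact ⟨_, rfl, rfl⟩

theorem exists_xMarkov_head {N : ℕ} {A : Fin N → Fin N → Bool}
    (hrow : ∀ i, ∃ j, A i j = true) (a : Fin N) : ∃ x : XMarkov A, x.1 0 = a := by
  choose f hf using hrow
  refine ⟨⟨fun n => f^[n] a, fun n => ?_⟩, rfl⟩
  simpa only [Function.iterate_succ_apply'] using hf (f^[n] a)

theorem exists_creation {N : ℕ} {A : Fin N → Fin N → Bool}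
    (hrow : ∀ i, ∃ j, A i j = true) {μ : List (Fin N)} (hadm : MarkovAdm A μ)
    (hμ : μ ≠ []) : ∃ x y : XMarkov A, applyWord A (μ.map Sum.inr) x = some y := by
  obtain ⟨b, hb⟩ := hrow (μ.getLast hμ)
  obtain ⟨x, rfl⟩ := exists_xMarkov_head hrow b
  obtain ⟨y, hy, -⟩ := exists_applyWord_map_inr μ x <| by
    refine List.isChain_append.2 ⟨hadm, by simp, ?_⟩
    simpa [List.getLast?_eq_some_getLast hμ] using hb
  exact ⟨x, y, hy⟩

/-- Lemma 2.3: for a `Λ_A`-admissible word `μ = μ₁⋯μ_l` and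
`1 ≤ k ≤ l`, the `k`-predecessor set of `β_{μ₁}⋯β_{μ_l}` in `D_A` coincides with
the `k`-predecessor set of the vertex `μ` in the Cantor horizon λ-graph system. -/
theorem stmt5 {N : ℕ} (hN : 2 ≤ N) (A : Fin N → Fin N → Bool)
    (hrow : ∀ i, ∃ j, A i j = true) (hcol : ∀ j, ∃ i, A i j = true)
    (μ : List (Fin N)) (hadm : MarkovAdm A μ) (k : ℕ) (hk1 : 1 ≤ k)
    (hkl : k ≤ μ.length) :
    {w : List (DyckSym N) | w.length = k ∧ DAdm A (w ++ μ.map Sum.inr)} =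
    {w : List (DyckSym N) | w.length = k ∧ RPathTo A w.reverse μ} := by
  have key : ∀ w : List (DyckSym N), w.length ≤ μ.length → ∀ x y : XMarkov A,
      applyWord A (μ.map Sum.inr) x = some y →
      ((applyWord A (w ++ μ.map Sum.inr) x).isSome ↔ RPathTo A w.reverse μ) := by
    intro w hw x y hy
    have h := isSome_applyWord_reverse_iff w.reverse μ.length (by simpa using hw) y
    rw [List.reverse_reverse, seqPrefix_of_applyWord_map_inr μ hy] at h
    rwa [applyWord_append, hy]
  ext w
  refine and_congr_right fun hw => ?_
  replace hw : w.length ≤ μ.length := hw ▸ hkl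
  constructor
  · rintro ⟨x, hx⟩
    have hx' := hx
    rw [applyWord_append] at hx'
    obtain ⟨y, hy⟩ := Option.isSome_iff_exists.1 (Option.isSome_of_isSome_bind hx')
    exact (key w hw x y hy).1 hx
  · intro hp
    obtain ⟨x, y, hy⟩ := exists_creation hrow hadm (by rintro rfl; simp at hkl; omega)
    exact ⟨x, (key w hw x y hy).2 hp⟩
end

section
/- (Lemma 3.5) Under the relations (1.1)–(1.4), for every Λ_A-admissible word μ₁⋯μ_l (l ≥ 1) the projection E_{μ₁⋯μ_l} commutes with S_j S_j* and with T_j T_j* for every j ∈ {1,…,N}. -/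
open scoped BigOperators

/-- `Eproj S [μ₁,…,μ_k] = S_{μ₁}*⋯S_{μ_k}* S_{μ_k}⋯S_{μ₁}` (and `Eproj S [] = 1`). -/
def Eproj {N : ℕ} {B : Type*} [Ring B] [StarRing B] (S : Fin N → B) :
    List (Fin N) → B
  | [] => 1
  | i :: w => star (S i) * Eproj S w * S i

/-- Projections in a unital C*-algebra that sum to `1` are mutually orthogonal. -/
theorem mul_eq_zero_of_sum_starProjection_eq_one {ι B : Type*} [Fintype ι] [CStarAlgebra B]
    {p : ι → B} (hp : ∀ a, IsStarProjection (p a)) (hsum : ∑ a, p a = 1) {a b : ι}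
    (hab : a ≠ b) : p a * p b = 0 := by
  classical
  let _ : PartialOrder B := CStarAlgebra.spectralOrder B
  have : StarOrderedRing B := CStarAlgebra.spectralOrderedRing B
  have hrest : ∑ c ∈ Finset.univ.erase b, star (p c * p b) * (p c * p b) = 0 := by
    have hterm (c : ι) : star (p c * p b) * (p c * p b) = p b * p c * p b := by
      rw [star_mul, (hp b).isSelfAdjoint.star_eq, (hp c).isSelfAdjoint.star_eq,
        mul_assoc, ← mul_assoc (p c) (p c), (hp c).isIdempotentElem.eq, mul_assoc]
    have hsplit := Finset.add_sum_erase Finset.univ (fun c => p b * p c * p b) (Finset.mem_univ b)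
    have hall : ∑ c, p b * p c * p b = p b * p b * p b := by
      rw [← Finset.sum_mul, ← Finset.mul_sum, hsum, mul_one, (hp b).isIdempotentElem.eq,
        (hp b).isIdempotentElem.eq]
    rw [hall] at hsplit
    simpa only [hterm] using left_eq_add.mp hsplit.symm
  have hzero := (Finset.sum_eq_zero_iff_of_nonneg fun c _ => star_mul_self_nonneg (p c * p b)).mp
    hrest a (Finset.mem_erase.mpr ⟨hab, Finset.mem_univ a⟩)
  exact CStarRing.star_mul_self_eq_zero_iff _ |>.mp hzero

/-- The range projection of a partial isometry is a projection. -/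
theorem isStarProjection_mul_star {B : Type*} [Ring B] [StarRing B] {v : B}
    (hv : v * star v * v = v) : IsStarProjection (v * star v) where
  isIdempotentElem := by rw [IsIdempotentElem, ← mul_assoc, hv]
  isSelfAdjoint := .mul_star_self v

/-- Compressions `p * x * p` commute with every element whose product with `p` is `p` or `0` on
either side. -/
theorem commute_compression {B : Type*} [Ring B] {p q : B} (x : B)
    (h : p * q = 0 ∧ q * p = 0 ∨ p * q = p ∧ q * p = p) : Commute (p * x * p) q := by
  have hcomm : p * x * (p * q) = q * p * x * p := by
    rcases h with ⟨h₁, h₂⟩ | ⟨h₁, h₂⟩ <;> simp [h₁, h₂]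
  simpa only [commute_iff_eq, mul_assoc] using hcomm

/-- An element which is a sum of compressions by pairwise orthogonal projections commutes with
each of these projections. -/
theorem commute_of_eq_sum_compression {ι κ B : Type*} [Fintype κ] [Ring B] {p : ι → B}
    (hp : ∀ a, IsIdempotentElem (p a)) (horth : ∀ a b, a ≠ b → p a * p b = 0)
    {s : κ → Prop} [DecidablePred s] (f : κ → ι) (g : ι) {x : B} (y : κ → B) (z : B)
    (hx : x = (∑ k, if s k then p (f k) * y k * p (f k) else 0) + p g * z * p g) (a : ι) :
    Commute x (p a) := by
  have hcomp (b : ι) (t : B) : Commute (p b * t * p b) (p a) := by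
    apply commute_compression
    by_cases hba : b = a
    · subst hba
      exact .inr ⟨hp b, hp b⟩
    · exact .inl ⟨horth _ _ hba, horth _ _ (Ne.symm hba)⟩
  rw [hx]
  refine (Commute.sum_left _ _ _ fun k _ => ?_).add_left (hcomp _ _)
  split_ifs
  · exact hcomp _ _
  · exact .zero_left _

/-- The recursion for `Eproj` on words of length at least two extends to all nonempty words when
the source projections of the `S j` sum to `1`. -/
theorem Eproj_cons_eq_of_sum_eq_one {N : ℕ} {A : Fin N → Fin N → Bool} {B : Type*} [Ring B]
    [StarRing B] {S T : Fin N → B} (hS : ∑ j, star (S j) * S j = 1)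
    (hrec : ∀ (i : Fin N) (w : List (Fin N)), w ≠ [] →
      Eproj S (i :: w) =
        (∑ j, if A j i then
          S j * star (S j) * Eproj S (i :: w) * (S j * star (S j)) else 0)
        + T i * Eproj S w * star (T i))
    (i : Fin N) (w : List (Fin N)) :
    Eproj S (i :: w) =
      (∑ j, if A j i then
        S j * star (S j) * Eproj S (i :: w) * (S j * star (S j)) else 0)
      + T i * Eproj S w * star (T i) := by
  by_cases hw : w = []
  · subst hw
    have hnil : ∑ k, Eproj S [k] = Eproj S [] := by simpa [Eproj] using hS
    have hone : ∑ k, Eproj S [i, k] = Eproj S [i] := by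
      simp only [Eproj] at hnil ⊢
      rw [← Finset.sum_mul, ← Finset.mul_sum, hnil]
    have hsum := Finset.sum_congr (rfl : Finset.univ = Finset.univ)
      fun k _ => hrec i [k] (List.cons_ne_nil _ _)
    rw [Finset.sum_add_distrib, Finset.sum_comm, ← Finset.sum_mul, ← Finset.mul_sum, hnil,
      hone] at hsum
    refine hsum.trans (congrArg (· + _) (Finset.sum_congr rfl fun j _ => ?_))
    split_ifs
    · rw [← Finset.sum_mul, ← Finset.mul_sum, hone]
    · exact Finset.sum_const_zero
  · exact hrec i w hw

/-- Lemma 3.5: under the relations (1.1)–(1.4), for every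
`Λ_A`-admissible word `μ₁⋯μ_l` (`l ≥ 1`) the projection `E_{μ₁⋯μ_l}` commutes
with every `S_j S_j*` and every `T_j T_j*`. -/
theorem stmt12 {N : ℕ} (hN : 2 ≤ N) (A : Fin N → Fin N → Bool)
    (hrow : ∀ i, ∃ j, A i j = true) (hcol : ∀ j, ∃ i, A i j = true)
    {B : Type*} [CStarAlgebra B] (S T : Fin N → B)
    (hSpi : ∀ i, S i * star (S i) * S i = S i)
    (hTpi : ∀ i, T i * star (T i) * T i = T i)
    (h11 : ∑ j, (S j * star (S j) + T j * star (T j)) = 1)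
    (h12 : ∑ j, star (S j) * S j = 1)
    (h13 : ∀ i, star (T i) * T i = ∑ j, if A i j then star (S j) * S j else 0)
    (h14 : ∀ (i : Fin N) (w : List (Fin N)), w ≠ [] →
      Eproj S (i :: w) =
        (∑ j, if A j i then
          S j * star (S j) * Eproj S (i :: w) * (S j * star (S j)) else 0)
        + T i * Eproj S w * star (T i))
    (μ : List (Fin N)) (hμ : μ ≠ []) (hadm : MarkovAdm A μ) (j : Fin N) :
    Commute (Eproj S μ) (S j * star (S j)) ∧
    Commute (Eproj S μ) (T j * star (T j)) := by
  obtain ⟨i, w, rfl⟩ := List.exists_cons_of_ne_nil hμ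
  let p : Fin N ⊕ Fin N → B :=
    Sum.elim (fun k => S k * star (S k)) (fun k => T k * star (T k))
  have hp : ∀ a, IsStarProjection (p a) := by
    rintro (k | k)
    · exact isStarProjection_mul_star (hSpi k)
    · exact isStarProjection_mul_star (hTpi k)
  have hsum : ∑ a, p a = 1 := by
    simpa [p, Finset.sum_add_distrib] using h11
  have hT : T i * Eproj S w * star (T i)
      = T i * star (T i) * (T i * Eproj S w * star (T i)) * (T i * star (T i)) := by
    have hstar : star (T i) * (T i * star (T i)) = star (T i) := by
      simpa [mul_assoc] using congrArg star (hTpi i)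
    rw [mul_assoc _ _ (T i * star (T i)), mul_assoc _ _ (T i * star (T i)), hstar,
      ← mul_assoc, ← mul_assoc, hTpi]
  have hE := Eproj_cons_eq_of_sum_eq_one h12 h14 i w
  rw [hT] at hE
  have hcomm := commute_of_eq_sum_compression (p := p) (fun a => (hp a).isIdempotentElem)
    (fun _ _ => mul_eq_zero_of_sum_starProjection_eq_one hp hsum) Sum.inl (Sum.inr i) _ _ hE
  exact ⟨hcomm (.inl j), hcomm (.inr j)⟩
end

section
/- (Lemma 3.6) Under the relations (1.1)–(1.4), for every word μ₁⋯μ_l over {1,…,N} that is NOT Λ_A-admissible, one has E_{μ₁⋯μ_l} = 0. -/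
open scoped BigOperators

/-- Projections in a C*-algebra that sum to `1` are mutually orthogonal. -/
lemma IsStarProjection.mul_eq_zero_of_sum_eq_one {ι B : Type*} [Fintype ι] [CStarAlgebra B]
    {p : ι → B} (hp : ∀ i, IsStarProjection (p i)) (hsum : ∑ i, p i = 1)
    {i j : ι} (hij : i ≠ j) : p i * p j = 0 := by
  classical
  let _ := CStarAlgebra.spectralOrder B
  have _ := CStarAlgebra.spectralOrderedRing B
  have hterm (k : ι) : p j * p k * p j = star (p k * p j) * (p k * p j) := by
    rw [star_mul, (hp k).isSelfAdjoint.star_eq, (hp j).isSelfAdjoint.star_eq,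
      mul_assoc (p j) (p k) (p k * p j), ← mul_assoc (p k) (p k) (p j),
      (hp k).isIdempotentElem.eq, mul_assoc]
  have htot : ∑ k, p j * p k * p j = p j := by
    rw [← Finset.sum_mul, ← Finset.mul_sum, hsum, mul_one, (hp j).isIdempotentElem.eq]
  have hzero : ∑ k ∈ Finset.univ.erase j, p j * p k * p j = 0 := by
    rw [← Finset.add_sum_erase _ _ (Finset.mem_univ j), (hp j).isIdempotentElem.eq,
      (hp j).isIdempotentElem.eq] at htot
    simpa using htot
  have h := (Finset.sum_eq_zero_iff_of_nonneg
    (fun k _ ↦ (hterm k).symm ▸ star_mul_self_nonneg _)).1 hzero i (by simp [hij])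
  rwa [hterm, CStarRing.star_mul_self_eq_zero_iff] at h

/-- The range projection of a partial isometry is a projection. -/
lemma isStarProjection_mul_star_self {B : Type*} [Semiring B] [StarRing B] {s : B}
    (hs : s * star s * s = s) : IsStarProjection (s * star s) :=
  ⟨by rw [IsIdempotentElem, ← mul_assoc, hs], .mul_star_self s⟩

lemma sum_Eproj_pair {N : ℕ} {B : Type*} [Ring B] [StarRing B] {S : Fin N → B}
    (h : ∑ j, star (S j) * S j = 1) (i : Fin N) :
    ∑ j, Eproj S [i, j] = Eproj S [i] := by
  simp only [Eproj, mul_one, ← Finset.sum_mul, ← Finset.mul_sum, h]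

/-- Lemma 3.6: under the relations (1.1)–(1.4), `E_{μ₁⋯μ_l} = 0`
for every word `μ₁⋯μ_l` that is not `Λ_A`-admissible. -/
theorem stmt13 {N : ℕ} (hN : 2 ≤ N) (A : Fin N → Fin N → Bool)
    (hrow : ∀ i, ∃ j, A i j = true) (hcol : ∀ j, ∃ i, A i j = true)
    {B : Type*} [CStarAlgebra B] (S T : Fin N → B)
    (hSpi : ∀ i, S i * star (S i) * S i = S i)
    (hTpi : ∀ i, T i * star (T i) * T i = T i)
    (h11 : ∑ j, (S j * star (S j) + T j * star (T j)) = 1)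
    (h12 : ∑ j, star (S j) * S j = 1)
    (h13 : ∀ i, star (T i) * T i = ∑ j, if A i j then star (S j) * S j else 0)
    (h14 : ∀ (i : Fin N) (w : List (Fin N)), w ≠ [] →
      Eproj S (i :: w) =
        (∑ j, if A j i then
          S j * star (S j) * Eproj S (i :: w) * (S j * star (S j)) else 0)
        + T i * Eproj S w * star (T i))
    (μ : List (Fin N)) (hμ : ¬ MarkovAdm A μ) :
    Eproj S μ = 0 := by
  have horth : ∀ {a b : Fin N ⊕ Fin N}, a ≠ b →
      Sum.elim S T a * star (Sum.elim S T a) * (Sum.elim S T b * star (Sum.elim S T b)) = 0 := by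
    intro a b hab
    refine IsStarProjection.mul_eq_zero_of_sum_eq_one
      (p := fun a ↦ Sum.elim S T a * star (Sum.elim S T a)) (fun c ↦ ?_) ?_ hab
    · cases c with
      | inl c => exact isStarProjection_mul_star_self (hSpi c)
      | inr c => exact isStarProjection_mul_star_self (hTpi c)
    · simpa [Finset.sum_add_distrib] using h11
  have hSS {i j : Fin N} (hij : i ≠ j) : S i * star (S i) * (S j * star (S j)) = 0 :=
    horth (a := .inl i) (b := .inl j) (by simpa using hij)
  have hST (i j : Fin N) : S i * star (S i) * T j = 0 := by
    have h : S i * star (S i) * (T j * star (T j)) = 0 :=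
      horth (a := .inl i) (b := .inr j) (by simp)
    rw [← hTpi j, ← mul_assoc, h, zero_mul]
  have hlong {i j : Fin N} (hij : ¬ A i j = true) {w : List (Fin N)} (hw : w ≠ []) :
      S i * star (S i) * Eproj S (j :: w) = 0 := by
    rw [h14 j w hw, mul_add, Finset.mul_sum, ← mul_assoc, ← mul_assoc, hST, zero_mul, zero_mul,
      add_zero]
    refine Finset.sum_eq_zero fun k _ ↦ ?_
    split_ifs with hk
    · have hik : i ≠ k := fun h ↦ hij (h ▸ hk)
      rw [mul_assoc (S k * star (S k)), ← mul_assoc, hSS hik, zero_mul]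
    · exact mul_zero _
  have hrange {i j : Fin N} (hij : ¬ A i j = true) (w : List (Fin N)) :
      S i * star (S i) * Eproj S (j :: w) = 0 := by
    by_cases hw : w = []
    · subst hw
      rw [← sum_Eproj_pair h12, Finset.mul_sum]
      exact Finset.sum_eq_zero fun k _ ↦ hlong hij (by simp)
    · exact hlong hij hw
  have hstar (i : Fin N) : star (S i) * (S i * star (S i)) = star (S i) := by
    simpa [mul_assoc] using congrArg star (hSpi i)
  induction μ with
  | nil => exact absurd List.isChain_nil hμ
  | cons i w ih =>
    by_cases hw : MarkovAdm A w
    · cases w with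
      | nil => exact absurd (List.isChain_singleton i) hμ
      | cons j w =>
        have hij : ¬ A i j = true := fun h ↦ hμ (List.isChain_cons_cons.2 ⟨h, hw⟩)
        rw [Eproj, ← hstar i, mul_assoc (star (S i)), hrange hij, mul_zero, zero_mul]
    · rw [Eproj, ih hw, mul_zero, zero_mul]
end
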